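/- There do not exist positive integers m₀, a₀ and a set W of positive integers of asymptotic density zero such that 𝒰 = {m₀ h + a₀ : h = 0, 1, 2, …} ∪ W. (That is, the conjecture of Erdős that 𝒰 is the union of a single infinite arithmetic progression of positive odd integers and a set of asymptotic density zero is false.) -/

import Mathlib

open Filter

/-- `U` is the set of positive odd integers that cannot be written as `p + 2^k`
with `p` prime and `k` a positive integer. -/
def U : Set ℕ :=
  {n | 0 < n ∧ Odd n ∧ ¬ ∃ (p k : ℕ), p.Prime ∧ 0 < k ∧ n = p + 2 ^ k}

/-- The infinite arithmetic progression `{m*h + a : h = 0, 1, 2, ...}`. -/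
def AP (m a : ℕ) : Set ℕ := {n | ∃ h : ℕ, n = m * h + a}

/-- A set of natural numbers has asymptotic density zero. -/
def DensityZero (S : Set ℕ) : Prop :=
  Tendsto (fun N : ℕ => (Nat.card ↥(S ∩ Set.Icc 1 N) : ℝ) / N) atTop (nhds 0)

/-- The primes of the Erdős covering system for the powers of two. -/
def coverPrimes : List ℕ := [3, 5, 7, 13, 17, 241]

/-- If every power of two is congruent to `a` modulo one of the covering primes, and no sum of a
covering prime and a power of two is congruent to `a` modulo `31`, then the progression
`346729110 * h + a` (with `346729110 = 2 * 3 * 5 * 7 * 13 * 17 * 241 * 31`) avoids all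
`p + 2 ^ k`. Since `2 ^ 120 ≡ 1` modulo all the odd primes involved, only the exponents below
`120` have to be inspected. -/
theorem AP_subset_U {a : ℕ} (ha : Odd a)
    (hcover : ∀ r < 120, ∃ q ∈ coverPrimes, 2 ^ r % q = a % q)
    (havoid : ∀ r < 120, ∀ q ∈ coverPrimes, (q + 2 ^ r) % 31 ≠ a % 31) :
    AP 346729110 a ⊆ U := by
  have hperiod (q k : ℕ) (hq : q ∣ 2 ^ 120 - 1) : 2 ^ k ≡ 2 ^ (k % 120) [MOD q] := by
    have h1 : 2 ^ 120 ≡ 1 [MOD q] := ((Nat.modEq_iff_dvd' (by norm_num)).2 hq).symm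
    calc 2 ^ k = (2 ^ 120) ^ (k / 120) * 2 ^ (k % 120) := by
          rw [← pow_mul, ← pow_add, Nat.div_add_mod]
      _ ≡ 1 ^ (k / 120) * 2 ^ (k % 120) [MOD q] := (h1.pow _).mul_right _
      _ = 2 ^ (k % 120) := by rw [one_pow, one_mul]
  have hprimes : ∀ q ∈ coverPrimes, q ≠ 1 ∧ q ∣ 346729110 ∧ q ∣ 2 ^ 120 - 1 := by
    simp only [coverPrimes, List.forall_mem_cons]
    norm_num
  have hAP (q h : ℕ) (hq : q ∣ 346729110) : 346729110 * h + a ≡ a [MOD q] := by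
    simpa using (((Nat.modEq_zero_iff_dvd.2 hq).mul_right h).add_right a)
  rintro n ⟨h, rfl⟩
  refine ⟨by have := ha.pos; omega, Even.add_odd ⟨173364555 * h, by ring⟩ ha, ?_⟩
  rintro ⟨p, k, hp, -, hn⟩
  have hr : k % 120 < 120 := Nat.mod_lt _ (by norm_num)
  obtain ⟨q, hq, hqa⟩ := hcover _ hr
  obtain ⟨hq1, hqm, hqd⟩ := hprimes q hq
  have hdvd : q ∣ p := by
    rw [← Nat.modEq_zero_iff_dvd]
    refine Nat.ModEq.add_right_cancel' (2 ^ k) ?_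
    rw [← hn, zero_add]
    exact (hAP q h hqm).trans ((hperiod q k hqd).trans hqa).symm
  obtain rfl : q = p := ((Nat.dvd_prime hp).1 hdvd).resolve_left hq1
  refine havoid _ hr q hq ?_
  have h31 := hAP 31 h (by norm_num)
  rw [hn] at h31
  exact ((hperiod 31 k (by norm_num)).symm.add_left q).trans h31

/-- A set of density zero misses two consecutive terms of every arithmetic progression. -/
theorem DensityZero.exists_consecutive_notMem {W : Set ℕ} (hW : DensityZero W) {m a : ℕ}
    (hm : 0 < m) (ha : 0 < a) : ∃ h, m * h + a ∉ W ∧ m * (h + 1) + a ∉ W := by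
  by_contra! hcon
  have hmem (h : ℕ) : ∃ e < 2, m * (2 * h + e) + a ∈ W := by
    by_cases h0 : m * (2 * h) + a ∈ W
    · exact ⟨0, by norm_num, h0⟩
    · exact ⟨1, by norm_num, hcon _ h0⟩
  choose e he hmemW using hmem
  have hcard (H : ℕ) :
      H ≤ Nat.card ↥(W ∩ Set.Icc 1 ((2 * m + a) * H)) := by
    have hfin : (W ∩ Set.Icc 1 ((2 * m + a) * H)).Finite :=
      (Set.finite_Icc _ _).subset Set.inter_subset_right
    have := hfin.to_subtype
    have hle (h : Fin H) : m * (2 * h + e h) + a ≤ (2 * m + a) * H := by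
      have h1 : 2 * (h : ℕ) + e h ≤ 2 * H := by have := he h; omega
      have h2 : 1 ≤ H := by omega
      nlinarith [Nat.mul_le_mul_left m h1, Nat.mul_le_mul_left a h2]
    let f : Fin H → ↥(W ∩ Set.Icc 1 ((2 * m + a) * H)) := fun h =>
      ⟨m * (2 * h + e h) + a, hmemW h, by omega, hle h⟩
    have hf : Function.Injective f := by
      intro x y hxy
      have h1 : m * (2 * x + e x) + a = m * (2 * y + e y) + a := congrArg Subtype.val hxy
      have h2 := Nat.eq_of_mul_eq_mul_left hm (Nat.add_right_cancel h1)
      have := he x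
      have := he y
      omega
    simpa using Nat.card_le_card_of_injective f hf
  have hsub : Tendsto (fun H : ℕ => (2 * m + a) * H) atTop atTop :=
    tendsto_id.const_mul_atTop' (by omega)
  have hpos : (0 : ℝ) < 1 / (2 * m + a : ℕ) := by positivity
  obtain ⟨H, hlt, hH⟩ :=
    (((hW.comp hsub).eventually_lt_const hpos).and (eventually_gt_atTop 0)).exists
  have hH' : (0 : ℝ) < H := by exact_mod_cast hH
  have hc : (H : ℝ) ≤ Nat.card ↥(W ∩ Set.Icc 1 ((2 * m + a) * H)) := by
    exact_mod_cast hcard H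
  rw [Function.comp_apply, Nat.cast_mul,
    div_lt_div_iff₀ (by positivity) (by positivity)] at hlt
  have hd : (0 : ℝ) < (2 * m + a : ℕ) := by positivity
  nlinarith

/-- A progression contained in another one up to a set of density zero has a compatible
difference and first term. -/
theorem dvd_of_AP_subset_union {m a m₀ a₀ : ℕ} {W : Set ℕ} (hW : DensityZero W) (hm : 0 < m)
    (ha : 0 < a) (hsub : AP m a ⊆ AP m₀ a₀ ∪ W) : m₀ ∣ m ∧ (m₀ : ℤ) ∣ a - a₀ := by
  obtain ⟨h, hh, hh'⟩ := hW.exists_consecutive_notMem hm ha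
  obtain ⟨x, hx⟩ := (hsub ⟨h, rfl⟩).resolve_right hh
  obtain ⟨y, hy⟩ := (hsub ⟨h + 1, rfl⟩).resolve_right hh'
  zify at hx hy
  have hdvd : (m₀ : ℤ) ∣ m := ⟨y - x, by linear_combination hy - hx⟩
  refine ⟨Int.natCast_dvd_natCast.1 hdvd, ?_⟩
  have : (a : ℤ) - a₀ = m₀ * x - m * h := by linear_combination hx
  rw [this]
  exact (dvd_mul_right _ _).sub (hdvd.mul_right _)

/-- The set `U` contains no full progression of difference `1` or `2`. -/
theorem not_AP_subset_U {m a : ℕ} (hm : m ∣ 2) : ¬ AP m a ⊆ U := by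
  intro hsub
  obtain ⟨d, hd⟩ := hm
  have ha : Odd a := (hsub ⟨0, by simp⟩).2.1
  obtain ⟨p, hp, hprime⟩ := Nat.exists_infinite_primes (a + 2)
  obtain ⟨b, rfl⟩ := ha
  obtain ⟨c, rfl⟩ := hprime.odd_of_ne_two (by omega)
  refine (hsub ⟨d * (c - b + 1), ?_⟩).2.2 ⟨2 * c + 1, 1, hprime, one_pos, rfl⟩
  rw [← mul_assoc, ← hd]
  omega

theorem stmt2 :
    ¬ ∃ (m₀ a₀ : ℕ) (W : Set ℕ),
      0 < m₀ ∧ 0 < a₀ ∧ (∀ n ∈ W, 0 < n) ∧ DensityZero W ∧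
      U = AP m₀ a₀ ∪ W := by
  rintro ⟨m₀, a₀, W, -, -, -, hW, hU⟩
  have h₁ : AP 346729110 18814027 ⊆ U :=
    AP_subset_U (by decide) (by decide +kernel) (by decide +kernel)
  have h₂ : AP 346729110 65590079 ⊆ U :=
    AP_subset_U (by decide) (by decide +kernel) (by decide +kernel)
  obtain ⟨hm, ha₁⟩ :=
    dvd_of_AP_subset_union hW (by norm_num) (by norm_num) (h₁.trans hU.subset)
  obtain ⟨-, ha₂⟩ :=
    dvd_of_AP_subset_union hW (by norm_num) (by norm_num) (h₂.trans hU.subset)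
  have hdiff : m₀ ∣ 46776052 := by
    have hsub := ha₂.sub ha₁
    rw [sub_sub_sub_cancel_right] at hsub
    simpa using Int.natCast_dvd.1 hsub
  have h2 : m₀ ∣ 2 := by simpa using Nat.dvd_gcd hm hdiff
  exact not_AP_subset_U h2 (Set.subset_union_left.trans hU.symm.subset)
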